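/- arXiv:0801.4076 — 2 statements merged into one kernel-verified Lean document; each statement's English description precedes it below -/
import Mathlib

section
/- Two composition algebras over k are isomorphic as unital algebras if and only if their norm forms are linearly equivalent (i.e., there is a linear isomorphism f : A → A' with n' ∘ f = n). -/
open QuadraticMap

section Composition

set_option linter.unusedSectionVars false

variable {k A A' ι : Type*} [Field k]
  [NonAssocRing A] [Module k A] [SMulCommClass k A A] [IsScalarTower k A A]
  [NonAssocRing A'] [Module k A'] [SMulCommClass k A' A'] [IsScalarTower k A' A']
  {n' : QuadraticForm k A'} {n : QuadraticForm k A}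

/-- A nondegenerate multiplicative quadratic form taking the value `1` at `1`. -/
structure IsCompositionNorm (n : QuadraticForm k A) : Prop where
  nondeg : ∀ a : A, (∀ b : A, polar n a b = 0) → a = 0
  map_mul : ∀ a b : A, n (a * b) = n a * n b
  map_one : n 1 = 1

/-- The conjugation of a unital algebra with respect to a quadratic form. -/
def normConj (n : QuadraticForm k A) (x : A) : A := polar n x 1 • (1 : A) - x

theorem polar_self_eq_two_mul (n : QuadraticForm k A) (x : A) : polar n x x = 2 * n x := by
  rw [polar_self, two_nsmul, two_mul]

theorem map_sub_smul_eq (n : QuadraticForm k A) (x v : A) (c : k) :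
    n (x - c • v) = n x + c * c * n v - c * polar n x v := by
  rw [sub_eq_add_neg, ← neg_smul, QuadraticMap.map_add n, QuadraticMap.map_smul, polar_smul_right]
  simp only [smul_eq_mul]
  ring

namespace IsCompositionNorm

theorem of_nontrivial [Nontrivial A]
    (hnd : ∀ a : A, (∀ b : A, polar n a b = 0) → a = 0)
    (hm : ∀ a b : A, n (a * b) = n a * n b) : IsCompositionNorm n := by
  refine ⟨hnd, hm, ?_⟩
  have h : n 1 * (n 1 - 1) = 0 := by
    have := hm 1 1
    rw [mul_one] at this
    linear_combination -this
  rcases mul_eq_zero.1 h with h | h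
  · have h0 : ∀ x, n x = 0 := fun x => by rw [← mul_one x, hm, h, mul_zero]
    exact absurd (hnd 1 fun b => by simp [polar, h0]) one_ne_zero
  · exact sub_eq_zero.1 h

theorem ext_polar (hn : IsCompositionNorm n) {a b : A} (h : ∀ z, polar n a z = polar n b z) :
    a = b :=
  sub_eq_zero.1 <| hn.nondeg _ fun z => by rw [polar_sub_left, h, sub_self]

theorem polar_mul_mul_left (hn : IsCompositionNorm n) (x y z : A) :
    polar n (x * y) (x * z) = n x * polar n y z := by
  simp only [polar, ← mul_add, hn.map_mul]
  ring

theorem polar_mul_mul_right (hn : IsCompositionNorm n) (x y z : A) :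
    polar n (y * x) (z * x) = polar n y z * n x := by
  simp only [polar, ← add_mul, hn.map_mul]
  ring

theorem polar_mul_mul_add (hn : IsCompositionNorm n) (x y z w : A) :
    polar n (x * y) (z * w) + polar n (x * w) (z * y) = polar n x z * polar n y w := by
  have h := hn.polar_mul_mul_left (x + z) y w
  simp only [add_mul, polar_add_left, polar_add_right, hn.polar_mul_mul_left,
    QuadraticMap.map_add n] at h
  rw [polar_comm n (x * w)]
  linear_combination h

theorem polar_one_one (hn : IsCompositionNorm n) : polar n (1 : A) 1 = 2 := by
  rw [polar_self_eq_two_mul, hn.map_one, mul_one]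

theorem polar_mul_left (hn : IsCompositionNorm n) (x y z : A) :
    polar n (x * y) z = polar n y (normConj n x * z) := by
  have h := hn.polar_mul_mul_add x y 1 z
  simp only [one_mul] at h
  rw [normConj, sub_mul, polar_sub_right, smul_mul_assoc, one_mul, polar_smul_right, smul_eq_mul,
    ← h, polar_comm n y (x * z)]
  ring

theorem polar_mul_right (hn : IsCompositionNorm n) (x y z : A) :
    polar n (x * y) z = polar n x (z * normConj n y) := by
  have h := hn.polar_mul_mul_add x y z 1
  simp only [mul_one] at h
  rw [normConj, mul_sub, polar_sub_right, mul_smul_comm, mul_one, polar_smul_right, smul_eq_mul]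
  linear_combination h

theorem polar_conj_one (hn : IsCompositionNorm n) (x : A) :
    polar n (normConj n x) 1 = polar n x 1 := by
  rw [normConj, polar_sub_left, polar_smul_left, hn.polar_one_one, smul_eq_mul]
  ring

theorem conj_conj (hn : IsCompositionNorm n) (x : A) : normConj n (normConj n x) = x := by
  rw [normConj, hn.polar_conj_one, normConj]
  abel

theorem map_conj (hn : IsCompositionNorm n) (x : A) : n (normConj n x) = n x := by
  rw [normConj, ← neg_sub, QuadraticMap.map_neg, map_sub_smul_eq, hn.map_one]
  ring

theorem conj_mul_mul (hn : IsCompositionNorm n) (x y : A) :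
    normConj n x * (x * y) = n x • y :=
  hn.ext_polar fun z => by
    rw [hn.polar_mul_left, hn.conj_conj, hn.polar_mul_mul_left, polar_smul_left, smul_eq_mul]

theorem mul_mul_conj (hn : IsCompositionNorm n) (x y : A) :
    y * x * normConj n x = n x • y :=
  hn.ext_polar fun z => by
    rw [hn.polar_mul_right, hn.conj_conj, hn.polar_mul_mul_right, polar_smul_left, smul_eq_mul,
      mul_comm]

theorem conj_add (n : QuadraticForm k A) (x y : A) :
    normConj n (x + y) = normConj n x + normConj n y := by
  simp only [normConj, polar_add_left, add_smul]
  abel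

theorem conj_mul_mul_add (hn : IsCompositionNorm n) (x y z : A) :
    normConj n x * (z * y) + normConj n z * (x * y) = polar n x z • y := by
  have h := hn.conj_mul_mul (x + z) y
  simp only [conj_add, add_mul, mul_add, hn.conj_mul_mul, QuadraticMap.map_add n, add_smul] at h
  rw [← sub_eq_zero] at h ⊢
  rw [← h]
  abel

theorem mul_mul_conj_add (hn : IsCompositionNorm n) (x y z : A) :
    y * x * normConj n z + y * z * normConj n x = polar n x z • y := by
  have h := hn.mul_mul_conj (x + z) y
  simp only [conj_add, add_mul, mul_add, hn.mul_mul_conj, QuadraticMap.map_add n, add_smul] at h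
  rw [← sub_eq_zero] at h ⊢
  rw [← h]
  abel

theorem conj_mul (hn : IsCompositionNorm n) (x y : A) :
    normConj n (x * y) = normConj n y * normConj n x :=
  hn.ext_polar fun z => by
    have h1 := hn.polar_mul_right z (x * y) 1
    have h2 := hn.polar_mul_left z (x * y) 1
    have h3 := hn.polar_mul_right x y (normConj n z)
    have h4 := hn.polar_mul_right (normConj n y) (normConj n x) z
    have h5 := hn.polar_mul_left z x (normConj n y)
    rw [one_mul] at h1
    rw [mul_one] at h2
    rw [hn.conj_conj] at h4
    rw [polar_comm, ← h1, h2, h3, h4, polar_comm n (normConj n y), h5]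

theorem mul_self (hn : IsCompositionNorm n) (x : A) :
    x * x = polar n x 1 • x - n x • (1 : A) := by
  have h := hn.mul_mul_conj x 1
  rw [one_mul, normConj, mul_sub, mul_smul_comm, mul_one] at h
  rw [← h]
  abel

theorem mul_right_cancel (hn : IsCompositionNorm n) {x y b : A} (hb : n b ≠ 0)
    (h : x * b = y * b) : x = y := by
  have h1 := hn.mul_mul_conj b x
  rw [h, hn.mul_mul_conj] at h1
  exact (smul_right_injective A hb h1).symm

theorem mul_left_cancel (hn : IsCompositionNorm n) {x y b : A} (hb : n b ≠ 0)
    (h : b * x = b * y) : x = y := by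
  have h1 := hn.conj_mul_mul b x
  rw [h, hn.conj_mul_mul] at h1
  exact (smul_right_injective A hb h1).symm

/-- The norm of a composition algebra is determined by its multiplication. -/
theorem map_algEquiv (hn : IsCompositionNorm n) (hn' : IsCompositionNorm n')
    (f : A ≃ₗ[k] A') (hf : ∀ x y, f (x * y) = f x * f y) (hf1 : f 1 = 1) (x : A) :
    n' (f x) = n x := by
  have h := congrArg f (hn.mul_self x)
  rw [hf, hn'.mul_self, map_sub, map_smul, map_smul, hf1] at h
  by_cases hc : polar n' (f x) 1 = polar n x 1
  · rw [hc, sub_right_inj, ← sub_eq_zero, ← sub_smul] at h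
    have h1 := congrArg n' h
    rw [QuadraticMap.map_smul, hn'.map_one, QuadraticMap.map_zero, smul_eq_mul, mul_one] at h1
    exact sub_eq_zero.1 (mul_self_eq_zero.1 h1)
  · have hs : f x = ((polar n' (f x) 1 - polar n x 1)⁻¹ * (n' (f x) - n x)) • (1 : A') := by
      rw [mul_smul, eq_inv_smul_iff₀ (sub_ne_zero.2 hc), sub_smul, sub_smul,
        sub_eq_sub_iff_add_eq_add]
      rw [sub_eq_sub_iff_add_eq_add] at h
      rw [h, add_comm]
    generalize (polar n' (f x) 1 - polar n x 1)⁻¹ * (n' (f x) - n x) = c at hs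
    have hx : x = c • (1 : A) := f.injective (by rw [hs, map_smul, hf1])
    rw [hs, hx, QuadraticMap.map_smul, QuadraticMap.map_smul, hn.map_one, hn'.map_one]

section Doubling

variable {D : Submodule k A} {b : A}

theorem conj_mem (h1 : (1 : A) ∈ D) {x : A} (hx : x ∈ D) : normConj n x ∈ D :=
  D.sub_mem (D.smul_mem _ h1) hx

theorem conj_of_orthogonal (h1 : (1 : A) ∈ D) (hb : ∀ x ∈ D, polar n b x = 0) :
    normConj n b = -b := by
  rw [normConj, hb 1 h1, zero_smul, zero_sub]

theorem polar_mul_orthogonal (hn : IsCompositionNorm n) (h1 : (1 : A) ∈ D)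
    (hD : ∀ x ∈ D, ∀ y ∈ D, x * y ∈ D) (hb : ∀ x ∈ D, polar n b x = 0) {x y : A}
    (hx : x ∈ D) (hy : y ∈ D) : polar n (y * b) x = 0 := by
  rw [hn.polar_mul_left]
  exact hb _ (hD _ (conj_mem h1 hy) _ hx)

theorem mul_eq_mul_conj (hn : IsCompositionNorm n) (h1 : (1 : A) ∈ D)
    (hD : ∀ x ∈ D, ∀ y ∈ D, x * y ∈ D) (hb : ∀ x ∈ D, polar n b x = 0) {x : A} (hx : x ∈ D) :
    x * b = b * normConj n x := by
  have h : normConj n (x * b) = -(x * b) := by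
    rw [normConj, hn.polar_mul_orthogonal h1 hD hb h1 hx, zero_smul, zero_sub]
  rw [hn.conj_mul, conj_of_orthogonal h1 hb, neg_mul, neg_inj] at h
  exact h.symm

theorem mul_mul_double (hn : IsCompositionNorm n) (h1 : (1 : A) ∈ D)
    (hD : ∀ x ∈ D, ∀ y ∈ D, x * y ∈ D) (hb : ∀ x ∈ D, polar n b x = 0) {x y : A}
    (hx : x ∈ D) (hy : y ∈ D) : x * (y * b) = y * x * b := by
  have h := hn.conj_mul_mul_add (normConj n x) (normConj n y) b
  rw [hn.conj_conj, conj_of_orthogonal h1 hb, polar_comm, hb _ (conj_mem h1 hx), zero_smul,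
    neg_mul, ← sub_eq_add_neg, sub_eq_zero, ← hn.conj_mul,
    ← hn.mul_eq_mul_conj h1 hD hb hy, ← hn.mul_eq_mul_conj h1 hD hb (hD _ hy _ hx)] at h
  exact h

theorem double_mul (hn : IsCompositionNorm n) (h1 : (1 : A) ∈ D)
    (hb : ∀ x ∈ D, polar n b x = 0) {x y : A} (hy : y ∈ D) :
    x * b * y = x * normConj n y * b := by
  have h := hn.mul_mul_conj_add b x (normConj n y)
  rw [hn.conj_conj, conj_of_orthogonal h1 hb, hb _ (conj_mem h1 hy), zero_smul,
    mul_neg, ← sub_eq_add_neg, sub_eq_zero] at h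
  exact h

theorem double_mul_double (hn : IsCompositionNorm n) (h1 : (1 : A) ∈ D)
    (hD : ∀ x ∈ D, ∀ y ∈ D, x * y ∈ D) (hb : ∀ x ∈ D, polar n b x = 0) {x y : A}
    (hx : x ∈ D) (hy : y ∈ D) : x * b * (y * b) = -(n b • (normConj n y * x)) := by
  have h := hn.conj_mul_mul_add (x * b) (normConj n y) b
  have hc : normConj n (x * b) = -(x * b) := by
    rw [normConj, hn.polar_mul_orthogonal h1 hD hb h1 hx, zero_smul, zero_sub]
  have hbb := hn.conj_mul_mul b (normConj n (x * y))
  have hp : polar n (x * b) b = polar n x 1 * n b := by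
    simpa using hn.polar_mul_mul_right b x 1
  rw [conj_of_orthogonal h1 hb, ← hn.mul_eq_mul_conj h1 hD hb (hD _ hx _ hy), hn.conj_mul] at hbb
  rw [hc, conj_of_orthogonal h1 hb, ← hn.mul_eq_mul_conj h1 hD hb hy,
    hn.double_mul h1 hb (conj_mem h1 hy), hn.conj_conj, hbb, hp] at h
  have hx' : normConj n y * normConj n x = polar n x 1 • normConj n y - normConj n y * x := by
    rw [show normConj n x = polar n x 1 • (1 : A) - x from rfl, mul_sub, mul_smul_comm, mul_one]
  rw [hx', smul_sub, smul_smul, mul_comm (n b)] at h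
  rw [neg_mul] at h
  have hsum : x * b * (y * b) + n b • (normConj n y * x) = 0 := by
    rw [← sub_eq_zero] at h
    rw [← neg_eq_zero, ← h]
    abel
  exact eq_neg_of_add_eq_zero_left hsum

/-- The Cayley–Dickson product. -/
theorem add_double_mul (hn : IsCompositionNorm n) (h1 : (1 : A) ∈ D)
    (hD : ∀ x ∈ D, ∀ y ∈ D, x * y ∈ D) (hb : ∀ x ∈ D, polar n b x = 0) {x y z w : A}
    (hx : x ∈ D) (hy : y ∈ D) (hz : z ∈ D) (hw : w ∈ D) :
    (x + y * b) * (z + w * b) =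
      (x * z - n b • (normConj n w * y)) + (w * x + y * normConj n z) * b := by
  rw [add_mul, mul_add, mul_add, hn.mul_mul_double h1 hD hb hx hw, hn.double_mul h1 hb hz,
    hn.double_mul_double h1 hD hb hy hw, add_mul]
  abel

theorem map_add_double (hn : IsCompositionNorm n) (h1 : (1 : A) ∈ D)
    (hD : ∀ x ∈ D, ∀ y ∈ D, x * y ∈ D) (hb : ∀ x ∈ D, polar n b x = 0) {x y : A}
    (hx : x ∈ D) (hy : y ∈ D) : n (x + y * b) = n x + n y * n b := by
  rw [QuadraticMap.map_add n, hn.map_mul, polar_comm, hn.polar_mul_orthogonal h1 hD hb hx hy,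
    add_zero]

/-- A subalgebra with an anisotropic vector in its orthogonal complement is associative,
provided the norm is nondegenerate on it. -/
theorem mul_assoc_of_orthogonal (hn : IsCompositionNorm n) (h1 : (1 : A) ∈ D)
    (hD : ∀ x ∈ D, ∀ y ∈ D, x * y ∈ D) (hb : ∀ x ∈ D, polar n b x = 0) (hb0 : n b ≠ 0)
    (hDn : ∀ x ∈ D, (∀ y ∈ D, polar n x y = 0) → x = 0) {x y z : A}
    (hx : x ∈ D) (hy : y ∈ D) (hz : z ∈ D) : x * y * z = x * (y * z) := by
  refine sub_eq_zero.1 (hDn _ (D.sub_mem (hD _ (hD _ hx _ hy) _ hz) (hD _ hx _ (hD _ hy _ hz)))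
    fun w hw => ?_)
  have h := hn.map_mul (y + w * b) (z + x * b)
  rw [hn.add_double_mul h1 hD hb hy hw hz hx,
    hn.map_add_double h1 hD hb hy hw, hn.map_add_double h1 hD hb hz hx,
    hn.map_add_double h1 hD hb
      (D.sub_mem (hD _ hy _ hz) (D.smul_mem _ (hD _ (conj_mem h1 hx) _ hw)))
      (D.add_mem (hD _ hx _ hy) (hD _ hw _ (conj_mem h1 hz))),
    map_sub_smul_eq, QuadraticMap.map_add n, hn.map_mul, hn.map_mul, hn.map_mul, hn.map_mul,
    hn.map_conj, hn.map_conj] at h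
  rw [polar_sub_left, hn.polar_mul_right (x * y) z w, hn.polar_mul_left x (y * z) w]
  have h' : n b * (polar n (x * y) (w * normConj n z)
      - polar n (y * z) (normConj n x * w)) = 0 := by
    linear_combination h
  exact (mul_eq_zero.1 h').resolve_left hb0

end Doubling

end IsCompositionNorm

/-- Two vectors of the same nonzero norm are exchanged by an isometry that fixes every
vector orthogonal to both. -/
theorem exists_isometry_apply_eq (h2 : (2 : k) ≠ 0) {u v : A} (huv : n u = n v) (hv : n v ≠ 0) :
    ∃ g : A ≃ₗ[k] A, (∀ x, n (g x) = n x) ∧ g u = v ∧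
      ∀ x, polar n u x = 0 → polar n v x = 0 → g x = x := by
  have key : ∀ w : A, n w ≠ 0 → ∃ g : A ≃ₗ[k] A, (∀ x, n (g x) = n x) ∧
      ∀ x, g x = x - ((n w)⁻¹ * polar n w x) • w := by
    intro w hw
    have h : ((n w)⁻¹ • (polarBilin n w)) w = 2 := by
      rw [LinearMap.smul_apply, polarBilin_apply_apply, polar_self_eq_two_mul, smul_eq_mul]
      field_simp
    have hg : ∀ x, Module.reflection h x = x - ((n w)⁻¹ * polar n w x) • w := fun x => by
      rw [Module.reflection_apply, LinearMap.smul_apply, polarBilin_apply_apply, smul_eq_mul]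
    refine ⟨Module.reflection h, fun x => ?_, hg⟩
    rw [hg, map_sub_smul_eq, polar_comm n x w]
    field_simp
    ring
  have hsub : n (u - v) = 2 * n v - polar n u v := by
    have := map_sub_smul_eq n u v 1
    rw [one_smul, huv] at this
    rw [this]; ring
  have hadd : n (u + v) = 2 * n v + polar n u v := by
    rw [QuadraticMap.map_add n, huv]; ring
  by_cases hs : n (u - v) = 0
  · have ha : n (u + v) ≠ 0 := by
      intro h0
      have : (2 * 2) * n v = 0 := by linear_combination h0 + hs - hsub - hadd
      exact mul_ne_zero (mul_ne_zero h2 h2) hv this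
    obtain ⟨g, hg, hga⟩ := key _ ha
    obtain ⟨r, hr, hra⟩ := key _ hv
    refine ⟨g.trans r, fun x => by rw [LinearEquiv.trans_apply, hr, hg], ?_, fun x hx hy => ?_⟩
    · have h1 : (n (u + v))⁻¹ * polar n (u + v) u = 1 := by
        rw [inv_mul_eq_one₀ ha, hadd, polar_add_left, polar_self_eq_two_mul, huv, polar_comm n v]
      have h3 : (n v)⁻¹ * polar n v (-v) = -2 := by
        rw [polar_neg_right, polar_self_eq_two_mul]; field_simp
      rw [LinearEquiv.trans_apply, hga, h1, one_smul, sub_add_cancel_left, hra, h3, neg_smul,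
        two_smul]
      abel
    · rw [LinearEquiv.trans_apply, hga, polar_add_left, hx, hy, add_zero, mul_zero, zero_smul,
        sub_zero, hra, hy, mul_zero, zero_smul, sub_zero]
  · obtain ⟨g, hg, hga⟩ := key _ hs
    refine ⟨g, hg, ?_, fun x hx hy => ?_⟩
    · have h1 : (n (u - v))⁻¹ * polar n (u - v) u = 1 := by
        rw [inv_mul_eq_one₀ hs, hsub, polar_sub_left, polar_self_eq_two_mul, huv, polar_comm n v]
      rw [hga, h1, one_smul, sub_sub_cancel]
    · rw [hga, polar_sub_left, hx, hy, sub_zero, mul_zero, zero_smul, sub_zero]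

theorem polar_map_isometry {f : A ≃ₗ[k] A'} (hf : ∀ x, n' (f x) = n x) (x y : A) :
    polar n' (f x) (f y) = polar n x y := by
  simp only [polar, ← map_add, hf]

/-- Witt extension for finite families of orthogonal anisotropic vectors. -/
theorem exists_isometry_apply_family_eq (h2 : (2 : k) ≠ 0) [Finite ι] {e : ι → A} {e' : ι → A'}
    (he0 : ∀ i, n (e i) ≠ 0) (he : ∀ i j, i ≠ j → polar n (e i) (e j) = 0)
    (hn : ∀ i, n' (e' i) = n (e i)) (he' : ∀ i j, i ≠ j → polar n' (e' i) (e' j) = 0)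
    (f : A ≃ₗ[k] A') (hf : ∀ x, n' (f x) = n x) :
    ∃ g : A ≃ₗ[k] A', (∀ x, n' (g x) = n x) ∧ ∀ i, g (e i) = e' i := by
  classical
  have key : ∀ s : Finset ι, ∃ g : A ≃ₗ[k] A', (∀ x, n' (g x) = n x) ∧
      ∀ i ∈ s, g (e i) = e' i := by
    intro s
    induction s using Finset.induction_on with
    | empty => exact ⟨f, hf, by simp⟩
    | insert j s hj ih =>
      obtain ⟨g, hg, hgs⟩ := ih
      obtain ⟨r, hr, hru, hrx⟩ := exists_isometry_apply_eq (n := n') h2 (u := g (e j)) (v := e' j)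
        (by rw [hg, hn]) (by rw [hn]; exact he0 j)
      refine ⟨g.trans r, fun x => by rw [LinearEquiv.trans_apply, hr, hg], fun i hi => ?_⟩
      rcases Finset.mem_insert.1 hi with rfl | hi
      · exact hru
      · have hji : j ≠ i := fun h => hj (h ▸ hi)
        rw [LinearEquiv.trans_apply, hgs i hi]
        refine hrx _ ?_ (he' _ _ hji)
        rw [← hgs i hi, polar_map_isometry hg, he _ _ hji]
  have := Fintype.ofFinite ι
  obtain ⟨g, hg, hge⟩ := key Finset.univ
  exact ⟨g, hg, fun i => hge i (Finset.mem_univ i)⟩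

/-- A family of orthogonal anisotropic vectors whose span is a unital subalgebra. -/
structure IsOrthogonalSubalgebra (n : QuadraticForm k A) (e : ι → A) : Prop where
  map_ne_zero : ∀ i, n (e i) ≠ 0
  polar_eq_zero : ∀ i j, i ≠ j → polar n (e i) (e j) = 0
  one_mem : (1 : A) ∈ Submodule.span k (Set.range e)
  mul_mem : ∀ x ∈ Submodule.span k (Set.range e), ∀ y ∈ Submodule.span k (Set.range e),
    x * y ∈ Submodule.span k (Set.range e)

theorem polar_eq_zero_of_mem_span {e : ι → A} {y : A} (h : ∀ i, polar n y (e i) = 0) {x : A}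
    (hx : x ∈ Submodule.span k (Set.range e)) : polar n y x = 0 := by
  have : Submodule.span k (Set.range e) ≤ LinearMap.ker (polarBilin n y) := by
    rw [Submodule.span_le]
    rintro _ ⟨i, rfl⟩
    exact h i
  exact this hx

theorem mem_span_sumElim_double {e : ι → A} {b x : A} :
    x ∈ Submodule.span k (Set.range (Sum.elim e fun i => e i * b)) ↔
      ∃ p ∈ Submodule.span k (Set.range e), ∃ q ∈ Submodule.span k (Set.range e),
        p + q * b = x := by
  have h : Set.range (fun i => e i * b) = LinearMap.mulRight k b '' Set.range e := by
    rw [← Set.range_comp]; rfl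
  rw [Set.Sum.elim_range, Submodule.span_union, Submodule.mem_sup, h, ← Submodule.map_span]
  simp [Submodule.mem_map]

namespace IsOrthogonalSubalgebra

variable {e : ι → A}

theorem exists_sub_orthogonal (h2 : (2 : k) ≠ 0) [Finite ι] (he : IsOrthogonalSubalgebra n e)
    (x : A) : ∃ p ∈ Submodule.span k (Set.range e),
      ∀ y ∈ Submodule.span k (Set.range e), polar n (x - p) y = 0 := by
  classical
  have := Fintype.ofFinite ι
  refine ⟨∑ i, ((2 * n (e i))⁻¹ * polar n x (e i)) • e i,
    Submodule.sum_mem _ fun i _ => Submodule.smul_mem _ _ (Submodule.subset_span ⟨i, rfl⟩),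
    fun y hy => polar_eq_zero_of_mem_span (fun j => ?_) hy⟩
  have hs : polar n (∑ i, ((2 * n (e i))⁻¹ * polar n x (e i)) • e i) (e j) =
      ∑ i, ((2 * n (e i))⁻¹ * polar n x (e i)) * polar n (e i) (e j) := by
    rw [← polarBilin_apply_apply, map_sum, LinearMap.sum_apply]
    simp
  rw [polar_sub_left, hs, Finset.sum_eq_single j
    (fun i _ hij => by rw [he.polar_eq_zero i j hij, mul_zero]) (by simp), polar_self_eq_two_mul]
  have := he.map_ne_zero j
  field_simp
  ring

theorem nondeg (h2 : (2 : k) ≠ 0) [Finite ι] (hn : IsCompositionNorm n)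
    (he : IsOrthogonalSubalgebra n e) {x : A}
    (hx : x ∈ Submodule.span k (Set.range e))
    (h : ∀ y ∈ Submodule.span k (Set.range e), polar n x y = 0) : x = 0 := by
  refine hn.nondeg _ fun z => ?_
  obtain ⟨p, hp, hz⟩ := he.exists_sub_orthogonal h2 z
  rw [← sub_add_cancel z p, polar_add_right, h p hp, polar_comm, hz x hx, add_zero]

theorem exists_anisotropic_orthogonal (h2 : (2 : k) ≠ 0) [Finite ι] (hn : IsCompositionNorm n)
    (he : IsOrthogonalSubalgebra n e) (htop : Submodule.span k (Set.range e) ≠ ⊤) :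
    ∃ b, n b ≠ 0 ∧ ∀ x ∈ Submodule.span k (Set.range e), polar n b x = 0 := by
  by_contra! hcon
  have h0 : ∀ b, (∀ x ∈ Submodule.span k (Set.range e), polar n b x = 0) → n b = 0 := by
    intro b hb
    by_contra hb0
    obtain ⟨x, hx, hbx⟩ := hcon b hb0
    exact hbx (hb x hx)
  refine htop (eq_top_iff.2 fun x _ => ?_)
  obtain ⟨p, hp, hx⟩ := he.exists_sub_orthogonal h2 x
  suffices x - p = 0 by rwa [sub_eq_zero.1 this]
  refine hn.nondeg _ fun z => ?_
  obtain ⟨q, hq, hz⟩ := he.exists_sub_orthogonal h2 z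
  rw [← sub_add_cancel z q, polar_add_right, hx q hq, add_zero, polar, h0 _ hx, h0 _ hz,
    h0 _ fun y hy => by rw [polar_add_left, hx y hy, hz y hy, add_zero]]
  simp

theorem double (hn : IsCompositionNorm n) (he : IsOrthogonalSubalgebra n e) {b : A}
    (hb0 : n b ≠ 0) (hb : ∀ x ∈ Submodule.span k (Set.range e), polar n b x = 0) :
    IsOrthogonalSubalgebra n (Sum.elim e fun i => e i * b) := by
  have hmem : ∀ i, e i ∈ Submodule.span k (Set.range e) :=
    fun i => Submodule.subset_span ⟨i, rfl⟩
  refine ⟨?_, ?_, ?_, ?_⟩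
  · rintro (i | i)
    · exact he.map_ne_zero i
    · simpa [hn.map_mul] using ⟨he.map_ne_zero i, hb0⟩
  · rintro (i | i) (j | j) hij
    · exact he.polar_eq_zero i j fun h => hij (h ▸ rfl)
    · rw [polar_comm]
      exact hn.polar_mul_orthogonal he.one_mem he.mul_mem hb (hmem i) (hmem j)
    · exact hn.polar_mul_orthogonal he.one_mem he.mul_mem hb (hmem j) (hmem i)
    · simp only [Sum.elim_inr]
      rw [hn.polar_mul_mul_right, he.polar_eq_zero i j fun h => hij (h ▸ rfl), zero_mul]
  · exact mem_span_sumElim_double.2 ⟨1, he.one_mem, 0, Submodule.zero_mem _, by simp⟩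
  · intro x hx y hy
    obtain ⟨p, hp, q, hq, rfl⟩ := mem_span_sumElim_double.1 hx
    obtain ⟨r, hr, s, hs, rfl⟩ := mem_span_sumElim_double.1 hy
    rw [hn.add_double_mul he.one_mem he.mul_mem hb hp hq hr hs]
    have hc : ∀ {x}, x ∈ Submodule.span k (Set.range e) →
      normConj n x ∈ Submodule.span k (Set.range e) := IsCompositionNorm.conj_mem he.one_mem
    exact mem_span_sumElim_double.2 ⟨_, Submodule.sub_mem _ (he.mul_mem _ hp _ hr)
      (Submodule.smul_mem _ _ (he.mul_mem _ (hc hs) _ hq)), _,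
      Submodule.add_mem _ (he.mul_mem _ hs _ hp) (he.mul_mem _ hq _ (hc hr)), rfl⟩

theorem singleton_one (hn : IsCompositionNorm n) :
    IsOrthogonalSubalgebra n fun _ : Unit => (1 : A) := by
  refine ⟨fun _ => by rw [hn.map_one]; exact one_ne_zero, fun i j h => absurd rfl h,
    Submodule.subset_span ⟨(), rfl⟩, fun x hx y hy => ?_⟩
  rw [Set.range_const] at hx hy ⊢
  obtain ⟨c, rfl⟩ := Submodule.mem_span_singleton.1 hx
  rw [smul_mul_assoc, one_mul]
  exact Submodule.smul_mem _ _ hy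

/-- A multiplicative isometry on a proper subalgebra can be adjusted so as to be multiplicative
on a double of it. -/
theorem exists_isometry_double (h2 : (2 : k) ≠ 0) [Finite ι] (hn : IsCompositionNorm n)
    (hn' : IsCompositionNorm n') (he : IsOrthogonalSubalgebra n e) (f : A ≃ₗ[k] A')
    (hf : ∀ x, n' (f x) = n x) (hf1 : f 1 = 1)
    (hfm : ∀ x ∈ Submodule.span k (Set.range e), ∀ y ∈ Submodule.span k (Set.range e),
      f (x * y) = f x * f y) {b : A} (hb0 : n b ≠ 0)
    (hb : ∀ x ∈ Submodule.span k (Set.range e), polar n b x = 0) :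
    ∃ g : A ≃ₗ[k] A', (∀ x, n' (g x) = n x) ∧ g 1 = 1 ∧
      ∀ x ∈ Submodule.span k (Set.range (Sum.elim e fun i => e i * b)),
      ∀ y ∈ Submodule.span k (Set.range (Sum.elim e fun i => e i * b)),
        g (x * y) = g x * g y := by
  set D := Submodule.span k (Set.range e) with hDdef
  have hmem : ∀ i, e i ∈ D := fun i => Submodule.subset_span ⟨i, rfl⟩
  have hmap : ∀ x ∈ D, f x ∈ D.map f.toLinearMap := fun x hx => ⟨x, hx, rfl⟩
  have h1' : (1 : A') ∈ D.map f.toLinearMap := ⟨1, he.one_mem, hf1⟩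
  have hD' : ∀ x ∈ D.map f.toLinearMap, ∀ y ∈ D.map f.toLinearMap,
      x * y ∈ D.map f.toLinearMap := by
    rintro _ ⟨x, hx, rfl⟩ _ ⟨y, hy, rfl⟩
    exact ⟨x * y, he.mul_mem x hx y hy, hfm x hx y hy⟩
  have hb' : ∀ x ∈ D.map f.toLinearMap, polar n' (f b) x = 0 := by
    rintro _ ⟨x, hx, rfl⟩
    exact (polar_map_isometry hf b x).trans (hb x hx)
  have hd := he.double hn hb0 hb
  obtain ⟨g, hg, hge⟩ := exists_isometry_apply_family_eq (n := n) (n' := n') h2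
    (e' := Sum.elim (fun i => f (e i)) fun i => f (e i) * f b)
    hd.map_ne_zero hd.polar_eq_zero
    (by
      rintro (i | i)
      · exact hf _
      · simp only [Sum.elim_inr]
        rw [hn'.map_mul, hn.map_mul, hf, hf])
    (by
      rintro (i | i) (j | j) hij
      · exact (polar_map_isometry hf _ _).trans (he.polar_eq_zero i j fun h => hij (h ▸ rfl))
      · rw [polar_comm]
        exact hn'.polar_mul_orthogonal h1' hD' hb' (hmap _ (hmem i)) (hmap _ (hmem j))
      · exact hn'.polar_mul_orthogonal h1' hD' hb' (hmap _ (hmem j)) (hmap _ (hmem i))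
      · simp only [Sum.elim_inr]
        rw [hn'.polar_mul_mul_right, polar_map_isometry hf,
          he.polar_eq_zero i j fun h => hij (h ▸ rfl), zero_mul]) f hf
  have hgD : ∀ x ∈ D, g x = f x := fun x hx =>
    LinearMap.eqOn_span (f := g.toLinearMap) (g := f.toLinearMap)
      (by rintro _ ⟨i, rfl⟩; exact hge (Sum.inl i)) hx
  have hgb : ∀ x ∈ D, g (x * b) = f x * f b := fun x hx =>
    LinearMap.eqOn_span (f := g.toLinearMap ∘ₗ LinearMap.mulRight k b)
      (g := LinearMap.mulRight k (f b) ∘ₗ f.toLinearMap)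
      (by rintro _ ⟨i, rfl⟩; exact hge (Sum.inr i)) hx
  have hfc : ∀ x, f (normConj n x) = normConj n' (f x) := fun x => by
    rw [normConj, normConj, map_sub, map_smul, hf1, ← polar_map_isometry hf x 1, hf1]
  have hc : ∀ {x}, x ∈ D → normConj n x ∈ D := IsCompositionNorm.conj_mem he.one_mem
  refine ⟨g, hg, by rw [hgD 1 he.one_mem, hf1], fun x hx y hy => ?_⟩
  obtain ⟨p, hp, q, hq, rfl⟩ := mem_span_sumElim_double.1 hx
  obtain ⟨r, hr, s, hs, rfl⟩ := mem_span_sumElim_double.1 hy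
  have m1 := he.mul_mem _ hp _ hr
  have m2 := he.mul_mem _ (hc hs) _ hq
  have m3 := he.mul_mem _ hs _ hp
  have m4 := he.mul_mem _ hq _ (hc hr)
  rw [hn.add_double_mul he.one_mem he.mul_mem hb hp hq hr hs, map_add, map_add, map_add,
    hgb _ (D.add_mem m3 m4), hgD _ (D.sub_mem m1 (D.smul_mem _ m2)), hgD p hp, hgD r hr,
    hgb q hq, hgb s hs,
    hn'.add_double_mul h1' hD' hb' (hmap p hp) (hmap q hq) (hmap r hr) (hmap s hs),
    map_sub, map_smul, map_add, hfm _ hp _ hr, hfm _ (hc hs) _ hq, hfm _ hs _ hp,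
    hfm _ hq _ (hc hr), hfc, hfc, hf]

end IsOrthogonalSubalgebra

/-- Composition algebras with isometric norms are isomorphic. -/
theorem IsCompositionNorm.exists_algEquiv_of_isometry (h2 : (2 : k) ≠ 0)
    (hn : IsCompositionNorm n) (hn' : IsCompositionNorm n') (f : A ≃ₗ[k] A')
    (hf : ∀ x, n' (f x) = n x) :
    ∃ g : A ≃ₗ[k] A', (∀ x y, g (x * y) = g x * g y) ∧ g 1 = 1 := by
  have o0 := IsOrthogonalSubalgebra.singleton_one hn
  obtain ⟨f0, hf0, hf01⟩ := exists_isometry_apply_family_eq (n := n) (n' := n') h2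
    (e' := fun _ : Unit => (1 : A')) o0.map_ne_zero o0.polar_eq_zero
    (fun _ => by rw [hn.map_one, hn'.map_one]) (fun i j h => absurd rfl h) f hf
  replace hf01 := hf01 ()
  have hf0m : ∀ x ∈ Submodule.span k (Set.range fun _ : Unit => (1 : A)),
      ∀ y ∈ Submodule.span k (Set.range fun _ : Unit => (1 : A)),
      f0 (x * y) = f0 x * f0 y := by
    intro x hx y _
    rw [Set.range_const] at hx
    obtain ⟨c, rfl⟩ := Submodule.mem_span_singleton.1 hx
    rw [smul_mul_assoc, one_mul, map_smul, map_smul, hf01, smul_mul_assoc, one_mul]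
  by_cases t0 : Submodule.span k (Set.range fun _ : Unit => (1 : A)) = ⊤
  · exact ⟨f0, fun x y => hf0m x (t0 ▸ Submodule.mem_top) y (t0 ▸ Submodule.mem_top), hf01⟩
  obtain ⟨a, ha0, ha⟩ := o0.exists_anisotropic_orthogonal h2 hn t0
  have o1 := o0.double hn ha0 ha
  obtain ⟨f1, hf1, hf11, hf1m⟩ := o0.exists_isometry_double h2 hn hn' f0 hf0 hf01 hf0m ha0 ha
  have ha1 := mem_span_sumElim_double.2 ⟨0, Submodule.zero_mem _, 1, o0.one_mem,
    (by rw [one_mul, zero_add] : (0 : A) + 1 * a = a)⟩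
  have hac := conj_of_orthogonal o0.one_mem ha
  generalize (Sum.elim (fun _ : Unit => (1 : A)) fun _ => 1 * a) = e1 at *
  by_cases t1 : Submodule.span k (Set.range e1) = ⊤
  · exact ⟨f1, fun x y => hf1m x (t1 ▸ Submodule.mem_top) y (t1 ▸ Submodule.mem_top), hf11⟩
  obtain ⟨b, hb0, hb⟩ := o1.exists_anisotropic_orthogonal h2 hn t1
  have o2 := o1.double hn hb0 hb
  obtain ⟨f2, hf2, hf21, hf2m⟩ := o1.exists_isometry_double h2 hn hn' f1 hf1 hf11 hf1m hb0 hb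
  by_cases t2 : Submodule.span k (Set.range (Sum.elim e1 fun i => e1 i * b)) = ⊤
  · exact ⟨f2, fun x y => hf2m x (t2 ▸ Submodule.mem_top) y (t2 ▸ Submodule.mem_top), hf21⟩
  obtain ⟨c, hc0, hc⟩ := o2.exists_anisotropic_orthogonal h2 hn t2
  have o3 := o2.double hn hc0 hc
  obtain ⟨f3, hf3, hf31, hf3m⟩ := o2.exists_isometry_double h2 hn hn' f2 hf2 hf21 hf2m hc0 hc
  have ha2 := mem_span_sumElim_double.2 ⟨a, ha1, 0, Submodule.zero_mem _,
    (by rw [zero_mul, add_zero] : a + 0 * b = a)⟩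
  have hb2 := mem_span_sumElim_double.2 ⟨0, Submodule.zero_mem _, 1, o1.one_mem,
    (by rw [one_mul, zero_add] : (0 : A) + 1 * b = b)⟩
  have ha3 := mem_span_sumElim_double.2 ⟨a, ha2, 0, Submodule.zero_mem _,
    (by rw [zero_mul, add_zero] : a + 0 * c = a)⟩
  have hb3 := mem_span_sumElim_double.2 ⟨b, hb2, 0, Submodule.zero_mem _,
    (by rw [zero_mul, add_zero] : b + 0 * c = b)⟩
  have hc3 := mem_span_sumElim_double.2 ⟨0, Submodule.zero_mem _, 1, o2.one_mem,
    (by rw [one_mul, zero_add] : (0 : A) + 1 * c = c)⟩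
  by_cases t3 : Submodule.span k (Set.range
      (Sum.elim (Sum.elim e1 fun i => e1 i * b) fun i => (Sum.elim e1 fun i => e1 i * b) i * c)) = ⊤
  · exact ⟨f3, fun x y => hf3m x (t3 ▸ Submodule.mem_top) y (t3 ▸ Submodule.mem_top), hf31⟩
  exfalso
  obtain ⟨d, hd0, hd⟩ := o3.exists_anisotropic_orthogonal h2 hn t3
  have hassoc := hn.mul_assoc_of_orthogonal o3.one_mem o3.mul_mem hd hd0
    (fun x hx => o3.nondeg h2 hn hx) ha3 hb3 hc3
  rw [hn.mul_mul_double o2.one_mem o2.mul_mem hc ha2 hb2] at hassoc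
  have hcomm := hn.mul_right_cancel hc0 hassoc
  rw [hn.mul_eq_mul_conj o1.one_mem o1.mul_mem hb ha1] at hcomm
  have h := hn.mul_left_cancel hb0 hcomm
  rw [hac, neg_eq_iff_add_eq_zero, ← two_smul k] at h
  refine ha0 ?_
  rw [(smul_eq_zero.1 h).resolve_left h2, QuadraticMap.map_zero]

end Composition

/-- Two composition algebras over a field `k` of characteristic ≠ 2 are
isomorphic as unital algebras if and only if their norm forms are linearly equivalent
(there is a linear isomorphism `f : A → A'` with `n' ∘ f = n`). -/
theorem stmt_14 {k A A' : Type*} [Field k]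
    [NonAssocRing A] [Module k A] [SMulCommClass k A A] [IsScalarTower k A A]
    [NonAssocRing A'] [Module k A'] [SMulCommClass k A' A'] [IsScalarTower k A' A']
    (h2 : (2 : k) ≠ 0)
    (n : QuadraticForm k A)
    (hnd : ∀ a : A, (∀ b : A, polar (⇑n) a b = 0) → a = 0)
    (hm : ∀ a b : A, n (a * b) = n a * n b)
    (n' : QuadraticForm k A')
    (hnd' : ∀ a : A', (∀ b : A', polar (⇑n') a b = 0) → a = 0)
    (hm' : ∀ a b : A', n' (a * b) = n' a * n' b) :
    (∃ f : A ≃ₗ[k] A', (∀ x y : A, f (x * y) = f x * f y) ∧ f 1 = 1) ↔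
    (∃ f : A ≃ₗ[k] A', ∀ x : A, n' (f x) = n x) := by
  rcases subsingleton_or_nontrivial A with hA | hA
  · constructor
    · rintro ⟨f, -⟩
      exact ⟨f, fun x => by rw [Subsingleton.elim x 0, map_zero, QuadraticMap.map_zero,
        QuadraticMap.map_zero]⟩
    · rintro ⟨f, -⟩
      have : Subsingleton A' := f.symm.injective.subsingleton
      exact ⟨f, fun _ _ => Subsingleton.elim _ _, Subsingleton.elim _ _⟩
  · have hn := IsCompositionNorm.of_nontrivial hnd hm
    constructor
    · rintro ⟨f, hf, hf1⟩
      have : Nontrivial A' := f.symm.surjective.nontrivial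
      exact ⟨f, hn.map_algEquiv (.of_nontrivial hnd' hm') f hf hf1⟩
    · rintro ⟨f, hf⟩
      have : Nontrivial A' := f.symm.surjective.nontrivial
      exact hn.exists_algEquiv_of_isometry h2 (.of_nontrivial hnd' hm') f hf
end

section
/- In H₃(O) the identities a^# × b^# + (a × b)^# = (a^# : b)b + (b^# : a)a and (a × b^# : a^# × b) = 3·det a·det b + (a : b)(a^# : b^#) hold for all a, b. -/
open QuadraticMap

variable {k : Type*} [Field k] {O : Type*} [NonAssocRing O] [Module k O]
  [SMulCommClass k O O] [IsScalarTower k O O]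

/-- The Cayley conjugate `ã = (a : e)e − a` in a composition algebra. -/
def cconj (n : QuadraticForm k O) (x : O) : O :=
  polar (⇑n) x 1 • (1 : O) - x

/-- An element of `H₃(O)` is encoded by its three diagonal entries `α₁, α₂, α₃ ∈ k`
together with the three octonion entries `a₁, a₂, a₃ ∈ O`. -/
abbrev H3 (k O : Type*) : Type _ := (Fin 3 → k) × (Fin 3 → O)

/-- The adjoint `a^# = Σᵢ (αⱼαₖ − n(aᵢ)) eᵢ + Σᵢ F̃ᵢ(aⱼaₖ − αᵢãᵢ)`, where `(i,j,k)` runs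
over even permutations of `(1,2,3)`. -/
def sharp (n : QuadraticForm k O) (a : H3 k O) : H3 k O :=
  (fun i => a.1 (i + 1) * a.1 (i + 2) - n (a.2 i),
   fun i => cconj n (a.2 (i + 1) * a.2 (i + 2) - a.1 i • cconj n (a.2 i)))

/-- The Freudenthal product `a × b = (a+b)^# − a^# − b^#`. -/
def fcross (n : QuadraticForm k O) (a b : H3 k O) : H3 k O :=
  sharp n (a + b) - sharp n a - sharp n b

/-- The scalar product `(a : b) = Σᵢ αᵢβᵢ + Σᵢ (aᵢ : bᵢ)` on `H₃(O)`. -/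
def sp (n : QuadraticForm k O) (a b : H3 k O) : k :=
  (∑ i, a.1 i * b.1 i) + ∑ i, polar (⇑n) (a.2 i) (b.2 i)

/-- The determinant `det a = (1/3)(a^# : a)`. -/
def det3 (n : QuadraticForm k O) (a : H3 k O) : k :=
  (3 : k)⁻¹ * sp n (sharp n a) a

set_option linter.unusedSectionVars false

section CompositionAlgebra

variable {n : QuadraticForm k O}

theorem polar_mul_mul_left (hm : ∀ a b : O, n (a * b) = n a * n b) (x y z : O) :
    polar n (x * y) (x * z) = n x * polar n y z := by
  simp only [polar, ← mul_add, hm]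
  ring

theorem polar_mul_mul_right (hm : ∀ a b : O, n (a * b) = n a * n b) (x y z : O) :
    polar n (x * z) (y * z) = polar n x y * n z := by
  simp only [polar, ← add_mul, hm]
  ring

theorem polar_mul_mul_add_polar_mul_mul (hm : ∀ a b : O, n (a * b) = n a * n b)
    (x y z w : O) :
    polar n (x * y) (z * w) + polar n (x * w) (z * y) = polar n x z * polar n y w := by
  have h := polar_mul_mul_left hm (x + z) y w
  simp only [add_mul, polar_add_left, polar_add_right, polar_mul_mul_left hm] at h
  rw [polar_comm n (x * w)]
  have h' : n (x + z) = polar n x z + n x + n z := by simp only [polar]; ring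
  rw [h'] at h
  linear_combination h

theorem polar_mul_left_eq (hm : ∀ a b : O, n (a * b) = n a * n b) (x y z : O) :
    polar n (x * y) z = polar n y (cconj n x * z) := by
  have h := polar_mul_mul_add_polar_mul_mul hm x y 1 z
  simp only [one_mul] at h
  simp only [cconj, sub_mul, smul_mul_assoc, one_mul, polar_sub_right, polar_smul_right,
    smul_eq_mul]
  rw [polar_comm n y (x * z)]
  linear_combination h

theorem polar_mul_right_eq (hm : ∀ a b : O, n (a * b) = n a * n b) (x y z : O) :
    polar n (x * y) z = polar n x (z * cconj n y) := by
  have h := polar_mul_mul_add_polar_mul_mul hm x y z 1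
  simp only [mul_one] at h
  simp only [cconj, mul_sub, mul_smul_comm, mul_one, polar_sub_right, polar_smul_right,
    smul_eq_mul]
  linear_combination h

theorem map_one_eq_one [Nontrivial O] (hnd : ∀ a : O, (∀ b : O, polar n a b = 0) → a = 0)
    (hm : ∀ a b : O, n (a * b) = n a * n b) : n 1 = 1 := by
  by_contra h
  have h0 : ∀ x, n x = 0 := fun x => by
    have := hm x 1
    rw [mul_one] at this
    have h2 : n x * (n 1 - 1) = 0 := by linear_combination -this
    exact (mul_eq_zero.mp h2).resolve_right (sub_ne_zero.mpr h)
  exact one_ne_zero (hnd (1 : O) fun b => by simp [polar, h0])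

theorem polar_one_one (h1 : n 1 = 1) : polar n (1 : O) 1 = 2 := by
  simp [polar_self, h1]

theorem cconj_cconj (h1 : n 1 = 1) (x : O) : cconj n (cconj n x) = x := by
  simp only [cconj, polar_sub_left, polar_smul_left, polar_one_one h1, smul_eq_mul]
  module

theorem cconj_add (x y : O) : cconj n (x + y) = cconj n x + cconj n y := by
  simp only [cconj, polar_add_left]
  module

theorem cconj_smul (c : k) (x : O) : cconj n (c • x) = c • cconj n x := by
  simp only [cconj, polar_smul_left, smul_eq_mul]
  module

theorem cconj_sub (x y : O) : cconj n (x - y) = cconj n x - cconj n y := by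
  simp only [cconj, polar_sub_left]
  module

theorem polar_cconj_left (x y : O) : polar n (cconj n x) y = polar n x (cconj n y) := by
  simp only [cconj, polar_sub_left, polar_smul_left, polar_sub_right, polar_smul_right,
    smul_eq_mul, polar_comm n 1 y]
  ring

theorem map_sub_eq (x y : O) : n (x - y) = n x + n y - polar n x y := by
  have h : polar n x (-y) = n (x - y) - n x - n y := by
    simp only [polar, QuadraticMap.map_neg, sub_eq_add_neg]
  rw [polar_neg_right] at h
  linear_combination -h

theorem map_cconj (h1 : n 1 = 1) (x : O) : n (cconj n x) = n x := by
  rw [cconj, map_sub_eq, QuadraticMap.map_smul, h1, polar_smul_left, polar_comm n 1 x]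
  simp

theorem eq_of_polar_eq (hnd : ∀ a : O, (∀ b : O, polar n a b = 0) → a = 0) {x y : O}
    (h : ∀ z, polar n x z = polar n y z) : x = y :=
  sub_eq_zero.mp <| hnd _ fun z => by rw [polar_sub_left, h, sub_self]

theorem cconj_mul (h1 : n 1 = 1) (hnd : ∀ a : O, (∀ b : O, polar n a b = 0) → a = 0)
    (hm : ∀ a b : O, n (a * b) = n a * n b) (x y : O) :
    cconj n (x * y) = cconj n y * cconj n x :=
  eq_of_polar_eq hnd fun z => by
    rw [polar_cconj_left, polar_mul_left_eq hm, polar_mul_left_eq hm, cconj_cconj h1,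
      polar_comm n (cconj n x), polar_mul_right_eq hm]

theorem mul_cconj_mul (hnd : ∀ a : O, (∀ b : O, polar n a b = 0) → a = 0)
    (hm : ∀ a b : O, n (a * b) = n a * n b) (h1 : n 1 = 1) (x y : O) :
    x * (cconj n x * y) = n x • y :=
  eq_of_polar_eq hnd fun z => by
    rw [polar_mul_left_eq hm, polar_mul_mul_left hm, map_cconj h1, polar_smul_left, smul_eq_mul]

theorem mul_mul_cconj (hnd : ∀ a : O, (∀ b : O, polar n a b = 0) → a = 0)
    (hm : ∀ a b : O, n (a * b) = n a * n b) (h1 : n 1 = 1) (x y : O) :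
    y * x * cconj n x = n x • y :=
  eq_of_polar_eq hnd fun z => by
    rw [polar_mul_right_eq hm, cconj_cconj h1, polar_mul_mul_right hm, polar_smul_left,
      smul_eq_mul, mul_comm]

/-- The middle Moufang identity, with the resulting product `x c x` evaluated. -/
theorem mul_mul_mul_eq (hnd : ∀ a : O, (∀ b : O, polar n a b = 0) → a = 0)
    (hm : ∀ a b : O, n (a * b) = n a * n b) (h1 : n 1 = 1) (x y z : O) :
    x * y * (z * x) = polar n x (cconj n z * cconj n y) • x - n x • (cconj n z * cconj n y) :=
  eq_of_polar_eq hnd fun w => by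
    have h := polar_mul_mul_add_polar_mul_mul hm x y w (cconj n x * cconj n z)
    rw [mul_cconj_mul hnd hm h1, polar_smul_left, smul_eq_mul] at h
    have hx : polar n x (cconj n z * cconj n y) = polar n y (cconj n x * cconj n z) := by
      rw [polar_comm, polar_mul_left_eq hm, cconj_cconj h1, polar_cconj_left, cconj_mul h1 hnd hm]
    have hw : polar n (cconj n z * cconj n y) w = polar n (cconj n z) (w * y) := by
      rw [polar_mul_right_eq hm, cconj_cconj h1]
    rw [polar_mul_right_eq hm, cconj_mul h1 hnd hm, polar_sub_left, polar_smul_left,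
      polar_smul_left, smul_eq_mul, smul_eq_mul, hx, hw]
    linear_combination h

/-- The trilinear form `(x y : z̃)` is invariant under cyclic permutations. -/
theorem polar_cconj_mul_cyclic (hm : ∀ a b : O, n (a * b) = n a * n b) (x y z : O) :
    polar n (cconj n (x * y)) z = polar n (cconj n (y * z)) x := by
  rw [polar_cconj_left, polar_cconj_left, polar_mul_left_eq hm, polar_mul_right_eq hm]

end CompositionAlgebra

section FreudenthalProduct

variable {n : QuadraticForm k O}

theorem fcross_eq (a b : H3 k O) : fcross n a b =
    (fun i => a.1 (i + 1) * b.1 (i + 2) + b.1 (i + 1) * a.1 (i + 2) - polar n (a.2 i) (b.2 i),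
     fun i => cconj n (a.2 (i + 1) * b.2 (i + 2) + b.2 (i + 1) * a.2 (i + 2)
      - a.1 i • cconj n (b.2 i) - b.1 i • cconj n (a.2 i))) := by
  ext i
  · simp only [fcross, sharp, polar, Prod.fst_sub, Prod.fst_add, Prod.snd_add, Pi.sub_apply,
      Pi.add_apply]
    ring
  · simp only [fcross, sharp, Prod.snd_sub, Prod.fst_add, Prod.snd_add, Pi.sub_apply,
      Pi.add_apply, ← cconj_sub]
    congr 1
    simp only [cconj_add, add_mul, mul_add]
    module

theorem sharp_add (a b : H3 k O) : sharp n (a + b) = sharp n a + sharp n b + fcross n a b := by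
  rw [fcross]
  abel

theorem sharp_smul (t : k) (a : H3 k O) : sharp n (t • a) = (t ^ 2) • sharp n a := by
  ext i
  · simp only [sharp, Prod.smul_fst, Prod.smul_snd, Pi.smul_apply, QuadraticMap.map_smul,
      smul_eq_mul]
    ring
  · simp only [sharp, Prod.smul_fst, Prod.smul_snd, Pi.smul_apply, ← cconj_smul]
    congr 1
    simp only [cconj_smul, smul_mul_assoc, mul_smul_comm, smul_eq_mul]
    module

theorem fcross_comm (a b : H3 k O) : fcross n a b = fcross n b a := by
  rw [fcross, fcross, add_comm a b]
  abel

theorem fcross_add_right (a b c : H3 k O) :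
    fcross n a (b + c) = fcross n a b + fcross n a c := by
  simp only [fcross_eq]
  ext i
  · simp only [Prod.fst_add, Prod.snd_add, Pi.add_apply, polar_add_right]
    ring
  · simp only [Prod.fst_add, Prod.snd_add, Pi.add_apply, ← cconj_add]
    congr 1
    simp only [cconj_add, add_mul, mul_add]
    module

theorem fcross_smul_right (t : k) (a b : H3 k O) :
    fcross n a (t • b) = t • fcross n a b := by
  simp only [fcross_eq]
  ext i
  · simp only [Prod.smul_fst, Prod.smul_snd, Pi.smul_apply, polar_smul_right, smul_eq_mul]
    ring
  · simp only [Prod.smul_fst, Prod.smul_snd, Pi.smul_apply, ← cconj_smul]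
    congr 1
    simp only [cconj_smul, smul_mul_assoc, mul_smul_comm, smul_eq_mul]
    module

theorem fcross_add_left (a b c : H3 k O) :
    fcross n (a + b) c = fcross n a c + fcross n b c := by
  simp only [fcross_comm _ c, fcross_add_right]

theorem fcross_smul_left (t : k) (a b : H3 k O) :
    fcross n (t • a) b = t • fcross n a b := by
  simp only [fcross_comm _ b, fcross_smul_right]

theorem fcross_self (a : H3 k O) : fcross n a a = (2 : k) • sharp n a := by
  rw [fcross, ← two_smul k a, sharp_smul]
  module

theorem sp_comm (a b : H3 k O) : sp n a b = sp n b a := by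
  simp only [sp, mul_comm, polar_comm n (a.2 _)]

theorem sp_add_left (a b c : H3 k O) : sp n (a + b) c = sp n a c + sp n b c := by
  simp only [sp, Prod.fst_add, Prod.snd_add, Pi.add_apply, polar_add_left, add_mul,
    Finset.sum_add_distrib]
  ring

theorem sp_smul_left (t : k) (a b : H3 k O) : sp n (t • a) b = t * sp n a b := by
  simp only [sp, Prod.smul_fst, Prod.smul_snd, Pi.smul_apply, polar_smul_left, smul_eq_mul,
    mul_add, Finset.mul_sum, mul_assoc]

theorem sp_add_right (a b c : H3 k O) : sp n a (b + c) = sp n a b + sp n a c := by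
  simp only [sp_comm a, sp_add_left]

theorem sp_smul_right (t : k) (a b : H3 k O) : sp n a (t • b) = t * sp n a b := by
  simp only [sp_comm a, sp_smul_left]

theorem sp_fcross_cyclic (h1 : n 1 = 1) (hm : ∀ a b : O, n (a * b) = n a * n b)
    (a b c : H3 k O) : sp n (fcross n a b) c = sp n (fcross n b c) a := by
  have e1 : (1 : Fin 3) + 1 = 2 := rfl
  have e2 : (1 : Fin 3) + 2 = 0 := rfl
  have e3 : (2 : Fin 3) + 1 = 0 := rfl
  have e4 : (2 : Fin 3) + 2 = 1 := rfl
  simp only [fcross_eq, sp, Fin.sum_univ_three, zero_add, e1, e2, e3, e4, cconj_sub, cconj_add,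
    cconj_smul, cconj_cconj h1, polar_sub_left, polar_add_left, polar_smul_left, smul_eq_mul]
  have T := polar_cconj_mul_cyclic hm
  rw [T (b.2 1) (c.2 2) (a.2 0), T (c.2 1) (b.2 2) (a.2 0), T (b.2 2) (c.2 0) (a.2 1),
    T (c.2 2) (b.2 0) (a.2 1), T (b.2 0) (c.2 1) (a.2 2), T (c.2 0) (b.2 1) (a.2 2),
    T (c.2 2) (a.2 0) (b.2 1), T (c.2 0) (a.2 1) (b.2 2), T (c.2 1) (a.2 2) (b.2 0)]
  simp only [polar_comm n (c.2 _), polar_comm n (b.2 _) (a.2 _)]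
  ring

theorem det3_eq (h1 : n 1 = 1) (h3 : (3 : k) ≠ 0) (hm : ∀ a b : O, n (a * b) = n a * n b)
    (a : H3 k O) (i : Fin 3) : det3 n a =
      a.1 i * a.1 (i + 1) * a.1 (i + 2) - a.1 i * n (a.2 i) - a.1 (i + 1) * n (a.2 (i + 1))
        - a.1 (i + 2) * n (a.2 (i + 2))
        + polar n (cconj n (a.2 (i + 1) * a.2 (i + 2))) (a.2 i) := by
  have e1 : (1 : Fin 3) + 1 = 2 := rfl
  have e2 : (1 : Fin 3) + 2 = 0 := rfl
  have e3 : (2 : Fin 3) + 1 = 0 := rfl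
  have e4 : (2 : Fin 3) + 2 = 1 := rfl
  rw [det3, inv_mul_eq_iff_eq_mul₀ h3]
  have T := polar_cconj_mul_cyclic hm
  have T1 := T (a.2 1) (a.2 2) (a.2 0)
  have T2 := T (a.2 2) (a.2 0) (a.2 1)
  simp only [sharp, sp, Fin.sum_univ_three, zero_add, e1, e2, e3, e4, cconj_sub, cconj_smul,
    cconj_cconj h1, polar_sub_left, polar_smul_left, smul_eq_mul, polar_self]
  fin_cases i <;>
  simp only [Fin.zero_eta, Fin.mk_one, Fin.reduceFinMk, zero_add, e1, e2, e3, e4]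
  · linear_combination -2 * T1 - T2
  · linear_combination T1 - T2
  · linear_combination T1 + 2 * T2

theorem sharp_sharp (h3 : (3 : k) ≠ 0) (h1 : n 1 = 1)
    (hnd : ∀ a : O, (∀ b : O, polar n a b = 0) → a = 0)
    (hm : ∀ a b : O, n (a * b) = n a * n b) (a : H3 k O) :
    sharp n (sharp n a) = det3 n a • a := by
  have e1 (i : Fin 3) : i + 1 + 1 = i + 2 := by rw [add_assoc]; rfl
  have e2 (i : Fin 3) : i + 1 + 2 = i := by rw [add_assoc]; exact add_zero i
  have e3 (i : Fin 3) : i + 2 + 1 = i := by rw [add_assoc]; exact add_zero i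
  have e4 (i : Fin 3) : i + 2 + 2 = i + 1 := by rw [add_assoc]; rfl
  ext i
  · simp only [Prod.smul_fst, Pi.smul_apply, smul_eq_mul, det3_eq h1 h3 hm a i, sharp, e1, e2, e3,
      e4, map_cconj h1, map_sub_eq, QuadraticMap.map_smul, hm, polar_smul_right, polar_cconj_left]
    ring
  · simp only [Prod.smul_snd, Pi.smul_apply, det3_eq h1 h3 hm a i, sharp, e1, e2, e3, e4]
    have h := mul_cconj_mul hnd hm h1 (cconj n (a.2 (i + 2))) (a.2 i)
    rw [cconj_cconj h1, map_cconj h1] at h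
    simp only [cconj_sub, cconj_smul, cconj_cconj h1, cconj_mul h1 hnd hm, sub_mul, mul_sub,
      smul_mul_assoc, mul_smul_comm, mul_mul_mul_eq hnd hm h1, mul_mul_cconj hnd hm h1, h,
      map_cconj h1, polar_cconj_left, polar_comm n (a.2 i)]
    module

theorem sp_sharp_self (h3 : (3 : k) ≠ 0) (a : H3 k O) : sp n (sharp n a) a = 3 * det3 n a := by
  rw [det3, mul_inv_cancel_left₀ h3]

theorem det3_add_smul (h1 : n 1 = 1) (h3 : (3 : k) ≠ 0)
    (hm : ∀ a b : O, n (a * b) = n a * n b) (a b : H3 k O) (t : k) :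
    det3 n (a + t • b) = det3 n a + t * sp n (sharp n a) b + t ^ 2 * sp n (sharp n b) a
      + t ^ 3 * det3 n b := by
  have hab : sp n (fcross n a b) a = 2 * sp n (sharp n a) b := by
    rw [← sp_fcross_cyclic h1 hm a a b, fcross_self, sp_smul_left]
  have hba : sp n (fcross n a b) b = 2 * sp n (sharp n b) a := by
    rw [sp_fcross_cyclic h1 hm a b b, fcross_self, sp_smul_left]
  apply mul_left_cancel₀ h3
  rw [← sp_sharp_self h3]
  simp only [sharp_add, sharp_smul, fcross_smul_right, sp_add_left, sp_add_right, sp_smul_left,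
    sp_smul_right, sp_sharp_self h3, hab, hba]
  ring

/-- The linearizations of `a^## = det a • a` of bidegrees `(3, 1)` and `(2, 2)`. -/
theorem sharp_sharp_linearized (h2 : (2 : k) ≠ 0) (h3 : (3 : k) ≠ 0) (h1 : n 1 = 1)
    (hnd : ∀ a : O, (∀ b : O, polar n a b = 0) → a = 0)
    (hm : ∀ a b : O, n (a * b) = n a * n b) (a b : H3 k O) :
    fcross n (sharp n a) (fcross n a b) = det3 n a • b + sp n (sharp n a) b • a ∧
    fcross n (sharp n a) (sharp n b) + sharp n (fcross n a b)
      = sp n (sharp n a) b • b + sp n (sharp n b) a • a := by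
  have key (t : k) := sharp_sharp h3 h1 hnd hm (a + t • b)
  simp only [det3_add_smul h1 h3 hm, sharp_add, sharp_smul, fcross_smul_left, fcross_smul_right,
    fcross_add_left, sharp_sharp h3 h1 hnd hm] at key
  have k1 := key 1
  have k2 := key (-1)
  have k3 := key 2
  constructor
  · have h6 : (6 : k) ≠ 0 := by
      rw [show (6 : k) = 2 * 3 by norm_num]
      exact mul_ne_zero h2 h3
    apply smul_right_injective _ h6
    simp only
    linear_combination (norm := module) (6 : k) • k1 - (2 : k) • k2 - k3
  · apply smul_right_injective _ h2
    simp only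
    linear_combination (norm := module) k1 + k2

end FreudenthalProduct

/-- In `H₃(O)` over a Cayley algebra `O` (an 8-dimensional composition
algebra over `k = ℝ` or `ℂ`), the identities
`a^# × b^# + (a × b)^# = (a^# : b)b + (b^# : a)a` and
`(a × b^# : a^# × b) = 3·det a·det b + (a : b)(a^# : b^#)` hold for all `a, b`. -/
theorem stmt_18 {k : Type*} [Field k] {O : Type*} [NonAssocRing O] [Module k O]
    [SMulCommClass k O O] [IsScalarTower k O O]
    (h2 : (2 : k) ≠ 0) (h3 : (3 : k) ≠ 0)
    (n : QuadraticForm k O)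
    (hnd : ∀ a : O, (∀ b : O, polar (⇑n) a b = 0) → a = 0)
    (hm : ∀ a b : O, n (a * b) = n a * n b)
    (hdim : Module.finrank k O = 8) :
    ∀ a b : H3 k O,
      fcross n (sharp n a) (sharp n b) + sharp n (fcross n a b)
        = sp n (sharp n a) b • b + sp n (sharp n b) a • a ∧
      sp n (fcross n a (sharp n b)) (fcross n (sharp n a) b)
        = 3 * det3 n a * det3 n b + sp n a b * sp n (sharp n a) (sharp n b) := by
  intro a b
  have : Nontrivial O := Module.nontrivial_of_finrank_pos (R := k) (by omega)
  have h1 := map_one_eq_one hnd hm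
  refine ⟨(sharp_sharp_linearized h2 h3 h1 hnd hm a b).2, ?_⟩
  rw [sp_comm, ← sp_fcross_cyclic h1 hm (fcross n a (sharp n b)), fcross_comm _ (sharp n a),
    (sharp_sharp_linearized h2 h3 h1 hnd hm a (sharp n b)).1, sp_add_left, sp_smul_left,
    sp_smul_left, sp_sharp_self h3]
  ring
end
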